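/- Let π be a dominant integral weight with Stab_W(π) = W_P, let u < w be π-minuscule elements in W^P, and set d = ℓ(w) − ℓ(u). Then there is a bijection between the set of reduced words of w u^{−1} and the set of maximal-length directed paths from u to w in W^P, sending a reduced word w u^{−1} = s_{β_1}·…·s_{β_d} (each β_i a simple root) to the path u = x_d →β_d x_{d−1} → ⋯ → x_1 →β_1 x_0 = w. -/

import Mathlib

open scoped Classical BigOperators

/-- A bundled setting for a finite crystallographic root system together with its
Weyl group, its action on the rational span of the weight lattice, reflections,
and the data of coefficients of roots in the basis of simple roots. -/
structure WeylSetting where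
  /-- index set of the Dynkin diagram (simple roots) -/
  I : Type
  [fintypeI : Fintype I]
  [decEqI : DecidableEq I]
  /-- rational span of the weight lattice -/
  V : Type
  [acg : AddCommGroup V]
  [mod : Module ℚ V]
  /-- the Weyl group -/
  W : Type
  [grp : Group W]
  /-- the action of the Weyl group on weights -/
  act : W →* (V ≃ₗ[ℚ] V)
  /-- the simple roots -/
  simple : I → V
  /-- the (finite) set of roots -/
  roots : Finset V
  /-- `coroot β μ` is the pairing `⟨μ, β∨⟩` -/
  coroot : V → (V →ₗ[ℚ] ℚ)
  /-- the reflection `s_β ∈ W` associated to a root `β` -/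
  srefl : V → W
  /-- coefficients of a positive root in the basis of simple roots -/
  posCoeff : V → I → ℕ
  simple_mem : ∀ i, simple i ∈ roots
  simple_indep : LinearIndependent ℚ simple
  roots_neg : ∀ β ∈ roots, -β ∈ roots
  root_pos_or_neg : ∀ β ∈ roots,
    (∃ c : I → ℚ, (∀ i, 0 ≤ c i) ∧ β = ∑ i, c i • simple i) ∨
    (∃ c : I → ℚ, (∀ i, 0 ≤ c i) ∧ -β = ∑ i, c i • simple i)
  coroot_self : ∀ β ∈ roots, coroot β β = 2
  crystallographic : ∀ β ∈ roots, ∀ γ ∈ roots, ∃ n : ℤ, coroot β γ = n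
  posCoeff_spec : ∀ β ∈ roots,
    (∃ c : I → ℚ, (∀ i, 0 ≤ c i) ∧ β = ∑ i, c i • simple i) →
    β = ∑ i, (posCoeff β i : ℚ) • simple i
  srefl_apply : ∀ β ∈ roots, ∀ v : V, act (srefl β) v = v - coroot β v • β
  act_faithful : ∀ g : W, (∀ v : V, act g v = v) → g = 1
  roots_invariant : ∀ g : W, ∀ β ∈ roots, act g β ∈ roots
  coroot_equivariant : ∀ g : W, ∀ β ∈ roots, ∀ v : V,
    coroot (act g β) (act g v) = coroot β v
  generated : ∀ g : W, ∃ l : List I, g = (l.map fun i => srefl (simple i)).prod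

namespace WeylSetting

attribute [instance] fintypeI decEqI acg mod grp

variable (D : WeylSetting)

/-- the simple reflection attached to a node of the Dynkin diagram -/
def s (i : D.I) : D.W := D.srefl (D.simple i)

/-- the product `s_{i_1} ⋯ s_{i_r}` of the simple reflections listed in `l` -/
def wordProd (l : List D.I) : D.W := (l.map D.s).prod

/-- `β` is a positive root: a root which is a nonnegative combination of simple roots -/
def IsPosRoot (β : D.V) : Prop :=
  β ∈ D.roots ∧ ∃ c : D.I → ℚ, (∀ i, 0 ≤ c i) ∧ β = ∑ i, c i • D.simple i

/-- the length of a Weyl group element -/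
noncomputable def length (g : D.W) : ℕ :=
  sInf {n | ∃ l : List D.I, l.length = n ∧ D.wordProd l = g}

/-- `l` is a reduced word for `g` -/
def IsReduced (l : List D.I) (g : D.W) : Prop :=
  D.wordProd l = g ∧ l.length = D.length g

/-- the number of reduced words of `g` -/
noncomputable def RedCard (g : D.W) : ℕ := Nat.card {l : List D.I // D.IsReduced l g}

/-- the (strong) Bruhat order on the Weyl group -/
def bruhatLE : D.W → D.W → Prop :=
  Relation.ReflTransGen
    (fun a b => (∃ β, D.IsPosRoot β ∧ b = D.srefl β * a) ∧ D.length a < D.length b)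

/-- strict (strong) Bruhat order -/
def bruhatLT (a b : D.W) : Prop := D.bruhatLE a b ∧ a ≠ b

/-- the left weak Bruhat order: `a ≤_L b` iff `ℓ(b a⁻¹) + ℓ(a) = ℓ(b)` -/
def weakLE (a b : D.W) : Prop := D.length (b * a⁻¹) + D.length a = D.length b

/-- the height of a positive root: the sum of its coefficients in the simple roots -/
noncomputable def ht (β : D.V) : ℕ := ∑ i, D.posCoeff β i

/-- an integral weight: the pairings with all positive coroots are integers -/
def IsIntegral (lam : D.V) : Prop :=
  ∀ β, D.IsPosRoot β → ∃ n : ℤ, D.coroot β lam = n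

/-- a dominant integral weight -/
def IsDominant (lam : D.V) : Prop :=
  D.IsIntegral lam ∧ ∀ i, 0 ≤ D.coroot (D.simple i) lam

/-- a pre-dominant integral weight: `⟨λ, β∨⟩ ≥ -1` for all positive roots `β` -/
def IsPreDominant (lam : D.V) : Prop :=
  D.IsIntegral lam ∧ ∀ β, D.IsPosRoot β → -1 ≤ D.coroot β lam

/-- the diagram `D(λ) = {β ∈ R⁺ : ⟨λ, β∨⟩ = -1}` of a pre-dominant weight -/
noncomputable def diagram (lam : D.V) : Finset D.V :=
  D.roots.filter fun β => D.IsPosRoot β ∧ D.coroot β lam = -1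

/-- `IsWeightPath λ [β₁, …, β_r]` says that
`λ = λ₀ →β₁ λ₁ →β₂ ⋯ →β_r λ_r` is a `λ`-path, i.e. each `β_j` is a positive
root, `⟨λ_{j-1}, β_j∨⟩ = -1` and `λ_j = s_{β_j}(λ_{j-1})`. -/
def IsWeightPath : D.V → List D.V → Prop
  | _, [] => True
  | lam, β :: rest =>
      D.IsPosRoot β ∧ D.coroot β lam = -1 ∧
        IsWeightPath (D.act (D.srefl β) lam) rest

/-- the term `1/β₁ ⋅ 1/(β₁+β₂) ⋅ … ⋅ 1/(β₁+⋯+β_r)` attached to a path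
`(β₁, …, β_r)`, computed in a field `F` via a linear embedding `emb`. -/
noncomputable def pathTerm {F : Type} [Field F] [Algebra ℚ F]
    (emb : D.V →ₗ[ℚ] F) (l : List D.V) : F :=
  ∏ j ∈ Finset.range l.length, (emb ((l.take (j + 1)).sum))⁻¹

/-- `w` is a π-minuscule element (in the sense of Peterson). -/
def IsMinuscule (pi : D.V) (w : D.W) : Prop :=
  ∃ l : List D.I, D.IsReduced l w ∧
    ∀ k : Fin l.length,
      D.coroot (D.simple (l.get k)) (D.act (D.wordProd (l.drop (k.val + 1))) pi) = 1

/-- the stabilizer `W_π = Stab_W(π)` of a weight -/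
def stab (pi : D.V) : Subgroup D.W where
  carrier := {g | D.act g pi = pi}
  one_mem' := by simp
  mul_mem' := by
    intro a b ha hb
    simp only [Set.mem_setOf_eq] at *
    calc D.act (a * b) pi = D.act a (D.act b pi) := by rw [map_mul]; rfl
    _ = pi := by rw [hb, ha]
  inv_mem' := by
    intro a ha
    simp only [Set.mem_setOf_eq] at *
    calc D.act a⁻¹ pi = D.act a⁻¹ (D.act a pi) := by rw [ha]
    _ = D.act (a⁻¹ * a) pi := by rw [map_mul]; rfl
    _ = pi := by simp

/-- `u` is the minimal-length representative of its coset `uH` -/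
def IsMinRep (H : Subgroup D.W) (u : D.W) : Prop :=
  ∀ g : D.W, u⁻¹ * g ∈ H → D.length u ≤ D.length g

/-- `a` and `b` lie in the same coset of `H`, i.e. `aH = bH` -/
def SameCoset (H : Subgroup D.W) (a b : D.W) : Prop := a⁻¹ * b ∈ H

/-- `u →β w` in `W^P`: `β` is a positive root, `u, w` are minimal-length
representatives, `s_β w H = u H`, and `u < w` in Bruhat order -/
def Arrow (H : Subgroup D.W) (u w : D.W) (β : D.V) : Prop :=
  D.IsPosRoot β ∧ D.IsMinRep H u ∧ D.IsMinRep H w ∧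
    D.SameCoset H (D.srefl β * w) u ∧ D.bruhatLT u w

/-- `ArrowPath H w [β₁, …, β_r]` encodes a directed path
`x_r →β_r ⋯ → x_1 →β₁ x_0 = w` in the Bruhat graph on `W^P`. -/
def ArrowPath (H : Subgroup D.W) : D.W → List D.V → Prop
  | _, [] => True
  | w, β :: rest => ∃ u, D.Arrow H u w β ∧ ArrowPath H u rest

/-- directed paths as above whose vertices all lie above `v` in Bruhat order -/
def ArrowPathGE (H : Subgroup D.W) (v : D.W) : D.W → List D.V → Prop
  | _, [] => True
  | w, β :: rest => ∃ u, D.Arrow H u w β ∧ D.bruhatLE v u ∧ ArrowPathGE H v u rest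

/-- directed paths from `u` to `w`:
`u = x_r →β_r ⋯ → x_1 →β₁ x_0 = w` encoded by the list `[β₁, …, β_r]`. -/
def ArrowPathFromTo (H : Subgroup D.W) (u : D.W) : D.W → List D.V → Prop
  | w, [] => u = w
  | w, β :: rest => ∃ x, D.Arrow H x w β ∧ ArrowPathFromTo H u x rest

/-- `S(w) = {β ∈ R⁺ : s_β w < w}` -/
noncomputable def Sset (w : D.W) : Finset D.V :=
  D.roots.filter fun β => D.IsPosRoot β ∧ D.bruhatLT (D.srefl β * w) w

/-- `S(w/v) = {β ∈ R⁺ : v ≤ s_β w < w}` -/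
noncomputable def SsetSkew (v w : D.W) : Finset D.V :=
  D.roots.filter fun β =>
    D.IsPosRoot β ∧ D.bruhatLE v (D.srefl β * w) ∧ D.bruhatLT (D.srefl β * w) w

/-- an oriented edge `x → y` in the Bruhat graph of `G/P`: `x, y` are minimal
representatives, `xH < yH`, and `yH = x s_γ H` for some positive root `γ` -/
def GEdge (H : Subgroup D.W) (x y : D.W) : Prop :=
  D.IsMinRep H x ∧ D.IsMinRep H y ∧ D.bruhatLT x y ∧
    ∃ γ, D.IsPosRoot γ ∧ D.SameCoset H (x * D.srefl γ) y

/-- the (unique) positive root `γ` with `yH = x s_γ H` attached to an edge -/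
noncomputable def edgeRoot (H : Subgroup D.W) (x y : D.W) : D.V :=
  if h : ∃ γ, D.IsPosRoot γ ∧ D.SameCoset H (x * D.srefl γ) y then h.choose else 0

/-- `GChainTo H v t [x₁, …, x_r]` encodes a directed path
`v ≤ x_r → ⋯ → x_1 → x_0 = t` in the Bruhat graph of `G/P` -/
def GChainTo (H : Subgroup D.W) (v : D.W) : D.W → List D.W → Prop
  | _, [] => True
  | t, x :: rest => D.GEdge H x t ∧ D.bruhatLE v x ∧ GChainTo H v x rest

/-- the weighted term
`(m_Λ(x_r,x_{r-1})/W_Λ(x_r)) ⋯ (m_Λ(x_1,x_0)/W_Λ(x_1))` of a path in the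
`Λ`-Bruhat graph, computed in a field `F` via a linear embedding `emb`. -/
noncomputable def chainTerm {F : Type} [Field F] [Algebra ℚ F]
    (emb : D.V →ₗ[ℚ] F) (H : Subgroup D.W) (Lam : D.W → D.V) (w : D.W) :
    D.W → List D.W → F
  | _, [] => 1
  | t, x :: rest =>
      algebraMap ℚ F (D.coroot (D.edgeRoot H x t) (Lam x)) *
        (emb (D.act x (Lam x) - D.act w (Lam x)))⁻¹ *
        chainTerm emb H Lam w x rest

/-- the Bruhat order on cosets: `aH ≤ bH` -/
def cosetLE (H : Subgroup D.W) (a b : D.W) : Prop :=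
  ∃ x y, D.SameCoset H a x ∧ D.SameCoset H b y ∧ D.bruhatLE x y

/-- the (standard) parabolic subgroup generated by simple reflections in `J` -/
def parab (J : Set D.I) : Subgroup D.W := Subgroup.closure (D.s '' J)

/-- `X*(T)_P`: integral weights orthogonal to all coroots of `W_P`,
i.e. to `γ∨` for all positive roots `γ` in the span of the simple roots of `P` -/
def OrthWeightP (J : Set D.I) (lam : D.V) : Prop :=
  D.IsIntegral lam ∧
    ∀ γ, D.IsPosRoot γ → γ ∈ Submodule.span ℚ (D.simple '' J) → D.coroot γ lam = 0

/-- an admissible function `Λ : [v,w]^P → X*(T)_P` -/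
def Admissible (J : Set D.I) (v w : D.W) (Lam : D.W → D.V) : Prop :=
  (∀ x, D.IsMinRep (D.parab J) x → D.bruhatLE v x → D.bruhatLE x w →
      D.OrthWeightP J (Lam x)) ∧
  (∀ x, D.IsMinRep (D.parab J) x → D.bruhatLE v x → D.bruhatLE x w → x ≠ w →
      D.act x (Lam x) ≠ D.act w (Lam x))

/-- the subword of `l` with letters at the positions in `S`, in increasing order -/
def subwordF (l : List D.I) (S : Finset (Fin l.length)) : List D.I :=
  ((List.finRange l.length).filter fun j => j ∈ S).map l.get

/-- `β_j = s_{i_1} ⋯ s_{i_{j-1}}(α_{i_j})` attached to a reduced word `l` -/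
noncomputable def refRoot (l : List D.I) (j : Fin l.length) : D.V :=
  D.act (D.wordProd (l.take j.val)) (D.simple (l.get j))

/-- the Weyl group is simply laced: the Cartan pairing is symmetric -/
def SimplyLaced : Prop :=
  ∀ i j, D.coroot (D.simple i) (D.simple j) = D.coroot (D.simple j) (D.simple i)

/-- generating relation of the heap order of the word `l`:
`p_j < p_k` whenever `j < k` and `s_{i_j}`, `s_{i_k}` do not commute -/
def heapCovers (l : List D.I) (j k : Fin l.length) : Prop :=
  (j : ℕ) < (k : ℕ) ∧ D.s (l.get j) * D.s (l.get k) ≠ D.s (l.get k) * D.s (l.get j)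

/-- the heap order of the word `l`: the minimal partial order generated by
`heapCovers` -/
def heapLE (l : List D.I) : Fin l.length → Fin l.length → Prop :=
  Relation.ReflTransGen (D.heapCovers l)

/-- strict heap order -/
def heapLT (l : List D.I) (j k : Fin l.length) : Prop := D.heapLE l j k ∧ j ≠ k

/-- `F` is an order filter of the heap `H(w)` of the word `l` -/
def IsHeapFilter (l : List D.I) (F : Finset (Fin l.length)) : Prop :=
  ∀ j k, j ∈ F → D.heapLE l j k → k ∈ F

/-- `i` and `j` are joined by an edge of the Dynkin diagram -/
def adjDynkin (i j : D.I) : Prop := i ≠ j ∧ D.s i * D.s j ≠ D.s j * D.s i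

/-- an elementary excitation `A ▷ B` of subsets of the heap of the word `l` -/
def Excite (l : List D.I) (A B : Finset (Fin l.length)) : Prop :=
  ∃ p q, D.heapLT l p q ∧ l.get p = l.get q ∧ q ∈ A ∧ p ∈ B ∧
    A.erase q = B.erase p ∧
    (∀ z, D.heapLT l p z → D.heapLT l z q → l.get z ≠ l.get p) ∧
    ∀ u ∈ A, D.heapLE l p u → D.heapLE l u q → ¬ D.adjDynkin (l.get p) (l.get u)

/-- `A` is an excited diagram of `F` in the heap of the word `l`,
i.e. `A ∈ E_{H(w)}(F)` -/
def InExcited (l : List D.I) (F A : Finset (Fin l.length)) : Prop :=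
  Relation.ReflTransGen (D.Excite l) F A

end WeylSetting

namespace WeylSetting

variable {D : WeylSetting}

lemma act_mul (g k : D.W) (v : D.V) : D.act (g * k) v = D.act g (D.act k v) := by
  rw [map_mul]; rfl

lemma act_one (v : D.V) : D.act 1 v = v := by rw [map_one]; rfl

lemma act_inv_act (g : D.W) (v : D.V) : D.act g⁻¹ (D.act g v) = v := by
  rw [← act_mul, inv_mul_cancel, act_one]

lemma act_act_inv (g : D.W) (v : D.V) : D.act g (D.act g⁻¹ v) = v := by
  rw [← act_mul, mul_inv_cancel, act_one]

lemma act_ext {g k : D.W} (h : ∀ v, D.act g v = D.act k v) : g = k := by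
  have : k⁻¹ * g = 1 := D.act_faithful _ fun v => by rw [act_mul, h, act_inv_act]
  exact (inv_mul_eq_one.mp this).symm

lemma exists_coord (D : WeylSetting) : ∃ e : D.V →ₗ[ℚ] (D.I →₀ ℚ),
    ∀ i, e (D.simple i) = Finsupp.single i 1 := by
  obtain ⟨e, he⟩ := LinearMap.exists_leftInverse_of_injective
    (Finsupp.linearCombination ℚ D.simple) (LinearMap.ker_eq_bot.mpr D.simple_indep)
  refine ⟨e, fun i => ?_⟩
  have := LinearMap.congr_fun he (Finsupp.single i 1)
  simpa using this

noncomputable def coord (D : WeylSetting) : D.V →ₗ[ℚ] (D.I →₀ ℚ) := D.exists_coord.choose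

lemma coord_simple (i : D.I) : D.coord (D.simple i) = Finsupp.single i 1 :=
  D.exists_coord.choose_spec i

lemma coord_sum (c : D.I → ℚ) (j : D.I) : D.coord (∑ i, c i • D.simple i) j = c j := by
  simp [map_sum, coord_simple, Finsupp.finset_sum_apply, Finsupp.single_apply]

noncomputable def hgt (D : WeylSetting) : D.V →ₗ[ℚ] ℚ :=
  ∑ i, (Finsupp.lapply i) ∘ₗ D.coord

lemma hgt_apply (v : D.V) : D.hgt v = ∑ i, D.coord v i := by
  simp [hgt]

lemma hgt_simple (i : D.I) : D.hgt (D.simple i) = 1 := by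
  simp [hgt_apply, coord_simple, Finsupp.single_apply]

lemma simple_injective : Function.Injective D.simple := D.simple_indep.injective

lemma root_ne_zero {β : D.V} (h : β ∈ D.roots) : β ≠ 0 := by
  rintro rfl
  have := D.coroot_self 0 h
  simp at this

lemma pos_coord {β : D.V} (h : D.IsPosRoot β) (i : D.I) : 0 ≤ D.coord β i := by
  obtain ⟨-, c, hc, rfl⟩ := h
  rw [coord_sum]; exact hc i

lemma pos_hgt {β : D.V} (h : D.IsPosRoot β) :
    ∃ n : ℕ, 1 ≤ n ∧ D.hgt β = n ∧ (n = 1 → ∃ i, β = D.simple i) := by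
  have hs := D.posCoeff_spec β h.1 h.2
  have hh : D.hgt β = ((∑ i, D.posCoeff β i : ℕ) : ℚ) := by
    rw [hgt_apply]
    conv_lhs => rw [hs]
    push_cast
    exact Finset.sum_congr rfl fun i _ => coord_sum _ i
  refine ⟨_, ?_, hh, ?_⟩
  · by_contra hlt
    have h0 : ∑ i, D.posCoeff β i = 0 := by omega
    rw [Finset.sum_eq_zero_iff] at h0
    apply root_ne_zero h.1
    rw [hs]
    exact Finset.sum_eq_zero fun i hi => by simp [h0 i hi]
  · intro h1
    have : ∃ i, D.posCoeff β i ≠ 0 := by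
      by_contra hne
      push Not at hne
      simp [hne] at h1
    obtain ⟨i, hi⟩ := this
    have h2 := Finset.add_sum_erase Finset.univ (D.posCoeff β) (Finset.mem_univ i)
    have h3 : D.posCoeff β i = 1 := by omega
    have h4 : ∑ j ∈ Finset.univ.erase i, D.posCoeff β j = 0 := by omega
    rw [Finset.sum_eq_zero_iff] at h4
    refine ⟨i, ?_⟩
    rw [hs, ← Finset.add_sum_erase Finset.univ _ (Finset.mem_univ i), h3]
    rw [Finset.sum_eq_zero fun j hj => by simp [h4 j hj]]
    simp

lemma pos_hgt_pos {β : D.V} (h : D.IsPosRoot β) : 0 < D.hgt β := by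
  obtain ⟨n, hn, h1, -⟩ := pos_hgt h
  rw [h1]; exact_mod_cast hn

lemma not_pos_neg {β : D.V} (h : D.IsPosRoot β) (h' : D.IsPosRoot (-β)) : False := by
  have h1 := pos_hgt_pos h
  have h2 := pos_hgt_pos h'
  rw [map_neg] at h2
  linarith

lemma pos_or_neg {β : D.V} (h : β ∈ D.roots) : D.IsPosRoot β ∨ D.IsPosRoot (-β) := by
  rcases D.root_pos_or_neg β h with h1 | h1
  · exact Or.inl ⟨h, h1⟩
  · exact Or.inr ⟨D.roots_neg _ h, h1⟩

lemma simple_pos (i : D.I) : D.IsPosRoot (D.simple i) := by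
  refine ⟨D.simple_mem i, fun j => if j = i then 1 else 0, fun j => ?_, ?_⟩
  · dsimp only; split_ifs <;> simp
  · simp

lemma srefl_self {β : D.V} (h : β ∈ D.roots) : D.act (D.srefl β) β = -β := by
  rw [D.srefl_apply β h, D.coroot_self β h, two_smul]; abel

lemma srefl_sq {β : D.V} (h : β ∈ D.roots) : D.srefl β * D.srefl β = 1 := by
  apply D.act_faithful
  intro v
  rw [act_mul, D.srefl_apply β h v, map_sub, map_smul, srefl_self h, D.srefl_apply β h v]
  simp

lemma srefl_inv {β : D.V} (h : β ∈ D.roots) : (D.srefl β)⁻¹ = D.srefl β :=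
  inv_eq_of_mul_eq_one_left (srefl_sq h)

lemma srefl_conj (g : D.W) {β : D.V} (h : β ∈ D.roots) :
    D.srefl (D.act g β) = g * D.srefl β * g⁻¹ := by
  apply act_ext
  intro v
  rw [D.srefl_apply _ (D.roots_invariant g β h), act_mul, act_mul, D.srefl_apply β h, map_sub,
    map_smul, act_act_inv]
  have := D.coroot_equivariant g β h (D.act g⁻¹ v)
  rw [act_act_inv] at this
  rw [this]

lemma coroot_neg {β : D.V} (h : β ∈ D.roots) (v : D.V) : D.coroot (-β) v = - D.coroot β v := by
  have := D.coroot_equivariant (D.srefl β) β h (D.act (D.srefl β) v)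
  rw [← act_mul, srefl_sq h, act_one, srefl_self h, D.srefl_apply β h] at this
  rw [this, map_sub, map_smul, D.coroot_self β h]
  simp; ring

lemma coroot_act {β : D.V} (h : β ∈ D.roots) (g : D.W) (v : D.V) :
    D.coroot β (D.act g v) = D.coroot (D.act g⁻¹ β) v := by
  have := D.coroot_equivariant g⁻¹ β h (D.act g v)
  rw [act_inv_act] at this
  exact this.symm

lemma srefl_smul {α : D.V} {c : ℚ} (h : α ∈ D.roots) (h' : c • α ∈ D.roots) :
    D.srefl (c • α) = D.srefl α := by
  have hg : c * D.coroot (c • α) α = 2 := by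
    have := D.coroot_self _ h'
    simpa using this
  have ht : ∀ v, D.act (D.srefl (c • α) * D.srefl α) v
      = v + (D.coroot α v - c * D.coroot (c • α) v) • α := by
    intro v
    rw [act_mul, D.srefl_apply _ h, D.srefl_apply _ h', map_sub, map_smul, smul_smul]
    have : (D.coroot (c • α) v - D.coroot α v • D.coroot (c • α) α) * c
        = c * D.coroot (c • α) v - 2 * D.coroot α v := by
      rw [← hg]; simp; ring
    rw [this]
    module
  have hα : D.act (D.srefl (c • α) * D.srefl α) α = α := by
    rw [ht, hg, D.coroot_self α h]; simp
  have h1 : D.srefl (c • α) * D.srefl α = 1 := by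
    apply D.act_faithful
    intro v
    have := D.coroot_equivariant (D.srefl (c • α) * D.srefl α) α h v
    rw [hα, ht, map_add, map_smul, D.coroot_self α h] at this
    have h0 : D.coroot α v - c * D.coroot (c • α) v = 0 := by
      simp only [smul_eq_mul] at this; linarith
    rw [ht, h0]; simp
  rw [mul_eq_one_iff_eq_inv, srefl_inv h] at h1
  exact h1

lemma srefl_eq_of_neg {β : D.V} {i : D.I} (h : D.IsPosRoot β)
    (hn : D.IsPosRoot (-(D.act (D.s i) β))) : D.srefl β = D.s i := by
  have hc : ∀ j, j ≠ i → D.coord β j = 0 := by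
    intro j hj
    have h1 := pos_coord h j
    have h2 := pos_coord hn j
    rw [s, D.srefl_apply _ (D.simple_mem i)] at h2
    simp [coord_simple, Finsupp.single_apply, hj.symm] at h2
    linarith
  have hb : β = D.coord β i • D.simple i := by
    obtain ⟨hr, c, hc', rfl⟩ := h
    simp only [coord_sum] at hc ⊢
    rw [← Finset.add_sum_erase Finset.univ _ (Finset.mem_univ i)]
    rw [Finset.sum_eq_zero fun j hj => by rw [hc j (Finset.ne_of_mem_erase hj), zero_smul]]
    simp
  have hr := h.1
  rw [hb] at hr ⊢
  exact srefl_smul (D.simple_mem i) hr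

lemma s_sq (i : D.I) : D.s i * D.s i = 1 := srefl_sq (D.simple_mem i)

lemma s_inv (i : D.I) : (D.s i)⁻¹ = D.s i := srefl_inv (D.simple_mem i)

lemma s_s (i : D.I) (g : D.W) : D.s i * (D.s i * g) = g := by
  rw [← mul_assoc, s_sq, one_mul]

lemma act_s (i : D.I) (v : D.V) :
    D.act (D.s i) v = v - D.coroot (D.simple i) v • D.simple i :=
  D.srefl_apply _ (D.simple_mem i) v

lemma wordProd_nil : D.wordProd [] = 1 := rfl

lemma wordProd_cons (i : D.I) (l : List D.I) :
    D.wordProd (i :: l) = D.s i * D.wordProd l := by simp [wordProd]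

lemma wordProd_append (l m : List D.I) :
    D.wordProd (l ++ m) = D.wordProd l * D.wordProd m := by simp [wordProd]

lemma wordProd_reverse (l : List D.I) : D.wordProd l.reverse = (D.wordProd l)⁻¹ := by
  induction l with
  | nil => simp [wordProd]
  | cons i l ih =>
    rw [List.reverse_cons, wordProd_append, ih, wordProd_cons, wordProd_cons, wordProd_nil,
      mul_inv_rev, s_inv, mul_one]

lemma length_le (l : List D.I) : D.length (D.wordProd l) ≤ l.length :=
  Nat.sInf_le ⟨l, rfl, rfl⟩

lemma exists_word (g : D.W) : ∃ l : List D.I, l.length = D.length g ∧ D.wordProd l = g := by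
  have : D.length g ∈ {n | ∃ l : List D.I, l.length = n ∧ D.wordProd l = g} := by
    apply Nat.sInf_mem
    obtain ⟨l, hl⟩ := D.generated g
    exact ⟨_, l, rfl, hl.symm⟩
  exact this

lemma length_mul_le (g k : D.W) : D.length (g * k) ≤ D.length g + D.length k := by
  obtain ⟨l, hl, rfl⟩ := exists_word g
  obtain ⟨m, hm, rfl⟩ := exists_word k
  rw [← hl, ← hm, ← wordProd_append, ← List.length_append]
  exact length_le _

lemma length_s_le (i : D.I) : D.length (D.s i) ≤ 1 := by
  have := length_le (D := D) [i]
  simpa [wordProd] using this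

lemma length_s_mul_le (i : D.I) (g : D.W) : D.length (D.s i * g) ≤ D.length g + 1 := by
  have h1 := length_mul_le (D.s i) g
  have h2 := length_s_le (D := D) i
  omega

lemma length_le_s_mul (i : D.I) (g : D.W) : D.length g ≤ D.length (D.s i * g) + 1 := by
  have := length_s_mul_le i (D.s i * g)
  rwa [s_s] at this

lemma length_inv (g : D.W) : D.length g⁻¹ = D.length g := by
  have key : ∀ g : D.W, D.length g⁻¹ ≤ D.length g := by
    intro g
    obtain ⟨l, hl, rfl⟩ := exists_word g
    rw [← wordProd_reverse, ← hl, ← List.length_reverse]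
    exact length_le _
  apply le_antisymm (key g)
  have := key g⁻¹
  rwa [inv_inv] at this

lemma length_one : D.length (1 : D.W) = 0 := by
  have := length_le (D := D) []
  simpa [wordProd] using this

lemma eq_one_of_length {g : D.W} (h : D.length g = 0) : g = 1 := by
  obtain ⟨l, hl, rfl⟩ := exists_word g
  rw [h, List.length_eq_zero_iff] at hl
  rw [hl]; rfl

lemma exists_left {g : D.W} (h : D.length g ≠ 0) :
    ∃ i k, g = D.s i * k ∧ D.length g = D.length k + 1 := by
  obtain ⟨l, hl, rfl⟩ := exists_word g
  cases l with
  | nil => exact absurd hl.symm h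
  | cons i l =>
    refine ⟨i, D.wordProd l, wordProd_cons i l, ?_⟩
    have h1 := length_le l
    have h2 := length_s_mul_le i (D.wordProd l)
    rw [← wordProd_cons] at h2
    simp only [List.length_cons] at hl
    omega

lemma exchange (l : List D.I) : ∀ β : D.V, D.IsPosRoot β →
    D.IsPosRoot (-(D.act (D.wordProd l)⁻¹ β)) →
    ∃ l' : List D.I, l'.length + 1 = l.length ∧ D.srefl β * D.wordProd l = D.wordProd l' := by
  induction l with
  | nil =>
    intro β h h'
    rw [wordProd_nil, inv_one, act_one] at h'
    exact (not_pos_neg h h').elim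
  | cons i l ih =>
    intro β h h'
    rcases pos_or_neg (D.roots_invariant (D.s i) β h.1) with hp | hn
    · have : D.act (D.wordProd (i :: l))⁻¹ β
          = D.act (D.wordProd l)⁻¹ (D.act (D.s i) β) := by
        rw [wordProd_cons, mul_inv_rev, s_inv, act_mul]
      rw [this] at h'
      obtain ⟨l', hl, he⟩ := ih _ hp h'
      refine ⟨i :: l', by simp [hl], ?_⟩
      rw [wordProd_cons, wordProd_cons, ← he, srefl_conj _ h.1, s_inv]
      simp only [mul_assoc]
      rw [s_s]
    · refine ⟨l, by simp, ?_⟩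
      rw [srefl_eq_of_neg h hn, wordProd_cons, s_s]

lemma length_lt_of_neg {β : D.V} {x : D.W} (h : D.IsPosRoot β)
    (h' : D.IsPosRoot (-(D.act x⁻¹ β))) : D.length (D.srefl β * x) < D.length x := by
  obtain ⟨l, hl, rfl⟩ := exists_word x
  obtain ⟨l', hl', he⟩ := exchange l β h h'
  rw [he]
  have := length_le l'
  omega

lemma length_lt_of_pos {β : D.V} {x : D.W} (h : D.IsPosRoot β)
    (h' : D.IsPosRoot (D.act x⁻¹ β)) : D.length x < D.length (D.srefl β * x) := by
  have := length_lt_of_neg (x := D.srefl β * x) h (by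
    rw [mul_inv_rev, srefl_inv h.1, act_mul, srefl_self h.1, map_neg, neg_neg]; exact h')
  rwa [← mul_assoc, srefl_sq h.1, one_mul] at this

lemma pos_of_length_lt {β : D.V} {x : D.W} (h : D.IsPosRoot β)
    (hl : D.length x < D.length (D.srefl β * x)) : D.IsPosRoot (D.act x⁻¹ β) := by
  rcases pos_or_neg (D.roots_invariant x⁻¹ β h.1) with hp | hn
  · exact hp
  · have := length_lt_of_neg h hn
    omega

lemma length_s_ne (i : D.I) (x : D.W) : D.length (D.s i * x) ≠ D.length x := by
  rcases pos_or_neg (D.roots_invariant x⁻¹ _ (D.simple_mem i)) with hp | hn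
  · exact (length_lt_of_pos (simple_pos i) hp).ne'
  · exact (length_lt_of_neg (simple_pos i) hn).ne

lemma dominant_coord {pi : D.V} (hpi : D.IsDominant pi) (n : ℕ) : ∀ g : D.W, D.length g = n →
    ∀ j, 0 ≤ D.coord (pi - D.act g pi) j := by
  induction n with
  | zero =>
    intro g hg j
    rw [eq_one_of_length hg, act_one]; simp
  | succ n ih =>
    intro g hg j
    obtain ⟨i, k, hk, hl⟩ := exists_left (g := g⁻¹) (by rw [length_inv]; omega)
    rw [length_inv] at hl
    have hgk : g = k⁻¹ * D.s i := by
      rw [← inv_inv g, hk, mul_inv_rev, s_inv]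
    have hp : D.IsPosRoot (D.act k⁻¹ (D.simple i)) := by
      apply pos_of_length_lt (simple_pos i)
      change D.length k < D.length (D.s i * k)
      rw [← hk, length_inv]; omega
    have h1 := ih k⁻¹ (by rw [length_inv]; omega) j
    have h2 := pos_coord hp j
    have h3 := hpi.2 i
    have : pi - D.act g pi = (pi - D.act k⁻¹ pi)
        + D.coroot (D.simple i) pi • D.act k⁻¹ (D.simple i) := by
      rw [hgk, act_mul, act_s, map_sub, map_smul]; abel
    rw [this, map_add, map_smul]
    simp only [Finsupp.add_apply, Finsupp.smul_apply, smul_eq_mul]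
    positivity

lemma dominant_pos {pi : D.V} (hpi : D.IsDominant pi) {β : D.V} (h : D.IsPosRoot β) :
    0 ≤ D.coroot β pi := by
  by_contra hlt
  push Not at hlt
  have h1 : D.hgt (pi - D.act (D.srefl β) pi) ≥ 0 := by
    rw [hgt_apply]
    exact Finset.sum_nonneg fun j _ => dominant_coord hpi _ _ rfl j
  rw [D.srefl_apply _ h.1, sub_sub_cancel, map_smul, smul_eq_mul] at h1
  have := pos_hgt_pos h
  nlinarith

lemma integral_act {pi : D.V} (hpi : D.IsDominant pi) {β : D.V} (h : β ∈ D.roots) (g : D.W) :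
    ∃ n : ℤ, D.coroot β (D.act g pi) = n := by
  have hr := D.roots_invariant g⁻¹ β h
  rw [coroot_act h]
  rcases pos_or_neg hr with hp | hn
  · exact hpi.1 _ hp
  · obtain ⟨n, hn⟩ := hpi.1 _ hn
    rw [coroot_neg hr] at hn
    exact ⟨-n, by push_cast; linarith⟩

/-- negative pairing gives a length descent -/
lemma descent {pi : D.V} (hpi : D.IsDominant pi) {β : D.V} (h : D.IsPosRoot β) {x : D.W}
    (hx : D.coroot β (D.act x pi) < 0) : D.length (D.srefl β * x) < D.length x := by
  apply length_lt_of_neg h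
  rcases pos_or_neg (D.roots_invariant x⁻¹ β h.1) with hp | hn
  · have := dominant_pos hpi hp
    rw [coroot_act h.1] at hx
    linarith
  · exact hn

lemma mem_stab {pi : D.V} {a b : D.W} : a⁻¹ * b ∈ D.stab pi ↔ D.act a pi = D.act b pi := by
  change D.act (a⁻¹ * b) pi = pi ↔ _
  rw [act_mul]
  constructor
  · intro h
    rw [← act_act_inv a (D.act b pi), h]
  · intro h
    rw [← h, act_inv_act]

lemma minRep_iff {pi : D.V} {x : D.W} : D.IsMinRep (D.stab pi) x ↔
    ∀ g, D.act x pi = D.act g pi → D.length x ≤ D.length g := by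
  unfold IsMinRep
  simp only [mem_stab]

lemma minRep_step {pi : D.V} {x : D.W} {i : D.I} (hx : D.IsMinRep (D.stab pi) (D.s i * x))
    (hl : D.length (D.s i * x) = D.length x + 1) : D.IsMinRep (D.stab pi) x := by
  rw [minRep_iff] at *
  intro g hg
  have h1 := hx (D.s i * g) (by rw [act_mul, act_mul, hg])
  have h2 := length_s_mul_le i g
  omega

lemma pair_step {pi : D.V} (hpi : D.IsDominant pi) {x : D.W} {i : D.I}
    (hx : D.IsMinRep (D.stab pi) (D.s i * x))
    (hl : D.length (D.s i * x) = D.length x + 1) :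
    1 ≤ D.coroot (D.simple i) (D.act x pi) := by
  obtain ⟨n, hn⟩ := integral_act hpi (D.simple_mem i) x
  rw [hn]
  by_contra hlt
  have hn0 : n ≤ 0 := by
    by_contra h; apply hlt; exact_mod_cast (by omega : 1 ≤ n)
  rcases hn0.lt_or_eq with h | h
  · have : D.coroot (D.simple i) (D.act x pi) < 0 := by rw [hn]; exact_mod_cast h
    have : D.length (D.s i * x) < D.length x := descent hpi (simple_pos i) this
    omega
  · have h1 := (minRep_iff.mp hx) x (by rw [act_mul, act_s, hn, h]; simp)
    omega

lemma hgt_step {pi : D.V} (x : D.W) (i : D.I) :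
    D.hgt (pi - D.act (D.s i * x) pi) =
      D.hgt (pi - D.act x pi) + D.coroot (D.simple i) (D.act x pi) := by
  rw [act_mul, act_s]
  simp [hgt_simple]
  ring

lemma hgt_ge {pi : D.V} (hpi : D.IsDominant pi) (n : ℕ) : ∀ x : D.W, D.length x = n →
    D.IsMinRep (D.stab pi) x → (n : ℚ) ≤ D.hgt (pi - D.act x pi) := by
  induction n with
  | zero =>
    intro x hx _
    rw [eq_one_of_length hx, act_one]; simp
  | succ n ih =>
    intro x hx hm
    obtain ⟨i, k, rfl, hl⟩ := exists_left (g := x) (by omega)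
    have h1 := pair_step hpi hm hl
    have h2 := ih k (by omega) (minRep_step hm hl)
    rw [hgt_step]
    push_cast
    linarith

/-- minuscule minimal representatives, in terms of heights -/
def Mn (pi : D.V) (x : D.W) : Prop :=
  D.IsMinRep (D.stab pi) x ∧ D.hgt (pi - D.act x pi) = D.length x

lemma Mn_step {pi : D.V} (hpi : D.IsDominant pi) {x : D.W} {i : D.I}
    (hx : Mn pi (D.s i * x)) (hl : D.length (D.s i * x) = D.length x + 1) :
    Mn pi x ∧ D.coroot (D.simple i) (D.act x pi) = 1 := by
  have h0 := minRep_step hx.1 hl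
  have h1 := pair_step hpi hx.1 hl
  have h2 := hgt_ge hpi _ x rfl h0
  have h3 := hx.2
  rw [hgt_step, hl] at h3
  push_cast at h3
  exact ⟨⟨h0, by linarith⟩, by linarith⟩

lemma Mn_of_minuscule {pi : D.V} {x : D.W} (hx : D.IsMinRep (D.stab pi) x)
    (hm : D.IsMinuscule pi x) : Mn pi x := by
  refine ⟨hx, ?_⟩
  obtain ⟨l, ⟨rfl, hl⟩, h⟩ := hm
  rw [← hl]
  clear hl hx
  induction l with
  | nil => rw [wordProd_nil, act_one]; simp
  | cons i l ih =>
    have h0 := h ⟨0, by simp⟩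
    simp at h0
    rw [wordProd_cons, hgt_step, h0, ih]
    · simp
    · intro k
      have := h ⟨k.val + 1, by simp⟩
      simpa using this

lemma minRep_unique {pi : D.V} (hpi : D.IsDominant pi) (n : ℕ) : ∀ x y : D.W,
    D.length x = n → D.IsMinRep (D.stab pi) x → D.IsMinRep (D.stab pi) y →
    D.act x pi = D.act y pi → x = y := by
  induction n with
  | zero =>
    intro x y hx h1 h2 h
    have := (minRep_iff.mp h2) x h.symm
    rw [eq_one_of_length hx, eq_one_of_length (g := y) (by omega)]
  | succ n ih =>
    intro x y hx h1 h2 h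
    obtain ⟨i, k, rfl, hl⟩ := exists_left (g := x) (by omega)
    have hp := pair_step hpi h1 hl
    have hneg : D.coroot (D.simple i) (D.act y pi) < 0 := by
      rw [← h, act_mul, act_s, map_sub, map_smul, D.coroot_self _ (D.simple_mem i)]
      simp only [smul_eq_mul]; linarith
    have hlt : D.length (D.s i * y) < D.length y := descent hpi (simple_pos i) hneg
    have hge := length_le_s_mul i y
    have hmy : D.IsMinRep (D.stab pi) (D.s i * y) := by
      apply minRep_step (i := i)
      · rwa [s_s]
      · rw [s_s]; omega
    have := ih k (D.s i * y) (by omega) (minRep_step h1 hl) hmy (by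
      rw [act_mul, ← h, ← act_mul, s_s])
    rw [this, s_s]

/-! Bruhat order -/

lemma bruhat_length {a b : D.W} (h : D.bruhatLE a b) : a = b ∨ D.length a < D.length b := by
  induction h with
  | refl => exact Or.inl rfl
  | tail _ hs ih =>
    right
    rcases ih with rfl | h
    · exact hs.2
    · exact h.trans hs.2

lemma bruhatLT_length {a b : D.W} (h : D.bruhatLT a b) : D.length a < D.length b :=
  (bruhat_length h.1).resolve_left h.2

lemma bruhat_single {a : D.W} {β : D.V} (h : D.IsPosRoot β)
    (hl : D.length a < D.length (D.srefl β * a)) : D.bruhatLE a (D.srefl β * a) :=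
  Relation.ReflTransGen.single ⟨⟨β, h, rfl⟩, hl⟩

lemma bruhat_trans {a b c : D.W} (h : D.bruhatLE a b) (h' : D.bruhatLE b c) : D.bruhatLE a c :=
  Relation.ReflTransGen.trans h h'

noncomputable def mn (i : D.I) (x : D.W) : D.W :=
  if D.length (D.s i * x) < D.length x then D.s i * x else x

lemma mn_s (i : D.I) (x : D.W) : mn i (D.s i * x) = mn i x := by
  unfold mn
  rw [s_s]
  have := length_s_ne i x
  split_ifs <;> first | rfl | omega

lemma mn_step (i : D.I) {x : D.W} {β : D.V} (h : D.IsPosRoot β)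
    (hl : D.length x < D.length (D.srefl β * x)) :
    D.bruhatLE (mn i x) (mn i (D.srefl β * x)) := by
  by_cases hs : D.srefl β = D.s i
  · rw [hs, mn_s]; exact Relation.ReflTransGen.refl
  · have hp : D.IsPosRoot (D.act (D.s i) β) := by
      rcases pos_or_neg (D.roots_invariant (D.s i) β h.1) with hp | hn
      · exact hp
      · exact absurd (srefl_eq_of_neg h hn) hs
    have he : D.s i * (D.srefl β * x) = D.srefl (D.act (D.s i) β) * (D.s i * x) := by
      rw [srefl_conj _ h.1, s_inv]
      simp only [mul_assoc]
      rw [s_s]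
    have hl2 : D.length (D.s i * x) < D.length (D.srefl (D.act (D.s i) β) * (D.s i * x)) := by
      apply length_lt_of_pos hp
      rw [mul_inv_rev, s_inv, act_mul, ← act_mul (D.s i), s_sq, act_one]
      exact pos_of_length_lt h hl
    have hB : D.bruhatLE (D.s i * x) (D.s i * (D.srefl β * x)) := by
      rw [he]; exact bruhat_single hp hl2
    have hA := bruhat_single h hl
    unfold mn
    have hne := length_s_ne i x
    split_ifs with h1 h2 h2
    · exact hB
    · refine bruhat_trans ?_ hA
      have := bruhat_single (a := D.s i * x) (simple_pos i) (by
        change _ < D.length (D.s i * (D.s i * x)); rw [s_s]; exact h1)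
      change D.bruhatLE _ (D.s i * (D.s i * x)) at this
      rwa [s_s] at this
    · refine bruhat_trans ?_ hB
      exact bruhat_single (a := x) (simple_pos i) (by
        change _ < D.length (D.s i * x); omega)
    · exact hA

lemma mn_mono (i : D.I) {x y : D.W} (h : D.bruhatLE x y) :
    D.bruhatLE (mn i x) (mn i y) := by
  induction h with
  | refl => exact Relation.ReflTransGen.refl
  | tail _ hs ih =>
    obtain ⟨⟨β, hβ, rfl⟩, hl⟩ := hs
    exact bruhat_trans ih (mn_step i hβ hl)

/-! Bruhat order and weak order agree on minuscule elements -/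

lemma cartan_nonpos {i j : D.I} (h : j ≠ i) : D.coroot (D.simple i) (D.simple j) ≤ 0 := by
  have hr := D.roots_invariant (D.s i) _ (D.simple_mem j)
  rcases pos_or_neg hr with hp | hn
  · have := pos_coord hp i
    rw [act_s] at this
    simpa [coord_simple, Finsupp.single_apply, h] using this
  · have := pos_coord hn j
    rw [act_s] at this
    simp [coord_simple, Finsupp.single_apply, h.symm] at this
    linarith

lemma s_comm {i j : D.I} (h : D.coroot (D.simple i) (D.simple j) = 0) :
    D.s i * D.s j = D.s j * D.s i := by
  have h1 : D.act (D.s i) (D.simple j) = D.simple j := by rw [act_s, h]; simp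
  have h2 := srefl_conj (D.s i) (D.simple_mem j)
  rw [h1] at h2
  change D.s j = D.s i * D.s j * (D.s i)⁻¹ at h2
  exact (eq_mul_inv_iff_mul_eq.mp h2).symm

lemma word_length {l : List D.I} {x : D.W} {i : D.I}
    (hl : D.length (D.wordProd (i :: l) * x) = (i :: l).length + D.length x) :
    D.length (D.wordProd l * x) = l.length + D.length x ∧
    D.wordProd (i :: l) * x = D.s i * (D.wordProd l * x) ∧
    D.length (D.s i * (D.wordProd l * x)) = D.length (D.wordProd l * x) + 1 := by
  have he : D.wordProd (i :: l) * x = D.s i * (D.wordProd l * x) := by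
    rw [wordProd_cons, mul_assoc]
  have h1 := length_s_mul_le i (D.wordProd l * x)
  have h2 := length_mul_le (D.wordProd l) x
  have h3 := length_le l
  rw [he] at hl
  simp only [List.length_cons] at hl
  exact ⟨by omega, he, by omega⟩

/-- pairing decreases along a word avoiding `i`; equality forces commutation -/
lemma comm_of_pair {pi : D.V} (hpi : D.IsDominant pi) {i : D.I} {x : D.W} (l : List D.I) :
    Mn pi (D.wordProd l * x) → D.length (D.wordProd l * x) = l.length + D.length x → i ∉ l →
    D.coroot (D.simple i) (D.act x pi) ≤ D.coroot (D.simple i) (D.act (D.wordProd l * x) pi) ∧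
    (D.coroot (D.simple i) (D.act (D.wordProd l * x) pi) = D.coroot (D.simple i) (D.act x pi) →
      D.s i * D.wordProd l = D.wordProd l * D.s i) := by
  induction l with
  | nil =>
    intro _ _ _
    simp [wordProd]
  | cons j l ih =>
    intro hM hl hi
    obtain ⟨h1, h2, h3⟩ := word_length hl
    rw [h2] at hM
    obtain ⟨hM', hp⟩ := Mn_step hpi hM h3
    rw [List.mem_cons, not_or] at hi
    obtain ⟨ih1, ih2⟩ := ih hM' h1 hi.2
    have hc := cartan_nonpos (D := D) (i := i) (j := j) (Ne.symm hi.1)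
    have he : D.coroot (D.simple i) (D.act (D.wordProd (j :: l) * x) pi)
        = D.coroot (D.simple i) (D.act (D.wordProd l * x) pi)
          - D.coroot (D.simple i) (D.simple j) := by
      rw [h2, act_mul, act_s, hp]; simp
    rw [he]
    refine ⟨by linarith, fun h => ?_⟩
    have h5 := ih2 (by linarith)
    have h6 := s_comm (D := D) (i := i) (j := j) (by linarith)
    rw [wordProd_cons, ← mul_assoc, h6, mul_assoc, h5, mul_assoc]

lemma exists_last {α : Type} {a : α} : ∀ l : List α, a ∈ l → ∃ p q, l = p ++ a :: q ∧ a ∉ q := by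
  intro l hl
  obtain ⟨s, t, h, hn⟩ := List.eq_append_cons_of_mem (List.mem_reverse.mpr hl)
  refine ⟨t.reverse, s.reverse, ?_, by simpa using hn⟩
  rw [← List.reverse_reverse l, h]; simp

lemma word_suffix (p : List D.I) {q : List D.I} {x pi : D.W} {v : D.V} (hpi : D.IsDominant v) :
    Mn v (D.wordProd (p ++ q) * x) →
    D.length (D.wordProd (p ++ q) * x) = (p ++ q).length + D.length x →
    Mn v (D.wordProd q * x) ∧ D.length (D.wordProd q * x) = q.length + D.length x := by
  induction p with
  | nil => exact fun h h' => ⟨h, h'⟩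
  | cons i p ih =>
    intro hM hl
    rw [List.cons_append] at hM hl
    obtain ⟨h1, h2, h3⟩ := word_length hl
    rw [h2] at hM
    exact ih (Mn_step hpi hM h3).1 h1

theorem weak_of_bruhat {pi : D.V} (hpi : D.IsDominant pi) (n : ℕ) : ∀ u w : D.W,
    D.length w = n → Mn pi u → Mn pi w → D.bruhatLE u w →
    D.length (w * u⁻¹) + D.length u = D.length w := by
  induction n with
  | zero =>
    intro u w hw _ _ h
    rcases bruhat_length h with rfl | h
    · simp [length_one]
    · omega
  | succ n ih =>
    intro u w hw hMu hMw h
    have hsub : D.length w ≤ D.length (w * u⁻¹) + D.length u := by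
      have := length_mul_le (w * u⁻¹) u
      rwa [inv_mul_cancel_right] at this
    obtain ⟨i, w', rfl, hl⟩ := exists_left (g := w) (by omega)
    obtain ⟨hMw', hpw⟩ := Mn_step hpi hMw hl
    have hm := mn_mono i h
    rw [mn_s] at hm
    have hmw : mn i w' = w' := by
      unfold mn; rw [if_neg]; omega
    rw [hmw] at hm
    by_cases hlt : D.length (D.s i * u) < D.length u
    · have hmu : mn i u = D.s i * u := by unfold mn; rw [if_pos hlt]
      rw [hmu] at hm
      obtain ⟨u', rfl⟩ : ∃ u', u = D.s i * u' := ⟨D.s i * u, (s_s i u).symm⟩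
      rw [s_s] at hm hlt
      have hlu : D.length (D.s i * u') = D.length u' + 1 := by
        have := length_s_mul_le i u'
        omega
      obtain ⟨hMu', hpu⟩ := Mn_step hpi hMu hlu
      have hi := ih u' w' (by omega) hMu' hMw' hm
      obtain ⟨l, hll, hlp⟩ := exists_word (w' * u'⁻¹)
      have hwl : w' = D.wordProd l * u' := by rw [hlp]; group
      have hge : ∃ l' : List D.I, l'.length ≤ l.length ∧
          D.s i * D.wordProd l * D.s i = D.wordProd l' := by
        have hlen : D.length (D.wordProd l * u') = l.length + D.length u' := by
          rw [← hwl]; omega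
        rw [hwl] at hMw' hpw
        by_cases hil : i ∈ l
        · obtain ⟨p, q, rfl, hq⟩ := exists_last l hil
          obtain ⟨hM1, hl1⟩ := word_suffix (pi := 1) p hpi hMw' hlen
          obtain ⟨h1, h2, h3⟩ := word_length hl1
          rw [h2] at hM1
          obtain ⟨hM2, hp2⟩ := Mn_step hpi hM1 h3
          have hc := (comm_of_pair (i := i) hpi q hM2 h1 hq).2 (by rw [hp2, hpu])
          refine ⟨i :: (p ++ q), by simp, ?_⟩
          simp only [wordProd_cons, wordProd_append, mul_assoc]
          rw [← hc, s_s]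
        · have hc := (comm_of_pair (i := i) hpi l hMw' hlen hil).2 (by rw [hpw, hpu])
          refine ⟨l, le_rfl, ?_⟩
          rw [hc, mul_assoc, s_sq, mul_one]
      obtain ⟨l', hl', he⟩ := hge
      have heq : D.s i * w' * (D.s i * u')⁻¹ = D.wordProd l' := by
        rw [mul_inv_rev, s_inv, ← he, hlp]; simp only [mul_assoc]
      have := length_le l'
      rw [← heq] at this
      omega
    · have hmu : mn i u = u := by unfold mn; rw [if_neg hlt]
      rw [hmu] at hm
      have h1 := ih u w' (by omega) hMu hMw' hm
      have h2 := length_s_mul_le i (w' * u⁻¹)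
      rw [← mul_assoc] at h2
      omega

/-! Paths -/

lemma path_of_word {pi : D.V} (hpi : D.IsDominant pi) {u : D.W} (l : List D.I) :
    Mn pi (D.wordProd l * u) → D.length (D.wordProd l * u) = l.length + D.length u →
    D.ArrowPathFromTo (D.stab pi) u (D.wordProd l * u) (l.map D.simple) := by
  induction l with
  | nil =>
    intro _ _
    simp [wordProd, ArrowPathFromTo]
  | cons i l ih =>
    intro hM hl
    obtain ⟨h1, h2, h3⟩ := word_length hl
    rw [h2] at hM ⊢
    have hM' := (Mn_step hpi hM h3).1
    refine ⟨D.wordProd l * u, ⟨simple_pos i, hM'.1, hM.1, ?_, ?_, ?_⟩, ih hM' h1⟩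
    · change (D.s i * _)⁻¹ * _ ∈ _
      rw [s_s, inv_mul_cancel]; exact one_mem _
    · exact bruhat_single (simple_pos i) (by change _ < D.length (D.s i * _); omega)
    · intro he
      rw [← he] at h3
      omega

lemma arrow_weight {pi : D.V} (hpi : D.IsDominant pi) {x w : D.W} {β : D.V}
    (h : D.Arrow (D.stab pi) x w β) :
    ∃ k : ℕ, 1 ≤ k ∧ D.coroot β (D.act w pi) = -k ∧
      D.act x pi = D.act w pi + (k : ℚ) • β := by
  obtain ⟨hβ, hx, hw, hc, hlt⟩ := h
  have hl := bruhatLT_length hlt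
  have he : D.act (D.srefl β * w) pi = D.act x pi := mem_stab.mp hc
  rw [act_mul, D.srefl_apply _ hβ.1] at he
  obtain ⟨n, hn⟩ := integral_act hpi hβ.1 w
  have hneg : n < 0 := by
    by_contra hge
    push Not at hge
    rcases hge.lt_or_eq with hgt | h0
    · have hxneg : D.coroot β (D.act x pi) < 0 := by
        rw [← he, map_sub, map_smul, D.coroot_self _ hβ.1, hn]
        have : (0 : ℚ) < n := by exact_mod_cast hgt
        simp only [smul_eq_mul]; linarith
      have h1 := descent hpi hβ hxneg
      have h2 := (minRep_iff.mp hw) (D.srefl β * x) (by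
        rw [act_mul, ← he, ← D.srefl_apply _ hβ.1, ← act_mul, srefl_sq hβ.1, act_one])
      omega
    · have := (minRep_iff.mp hw) x (by rw [← he, hn, ← h0]; simp)
      omega
  obtain ⟨k, hk⟩ : ∃ k : ℕ, n = -k := ⟨n.natAbs, by omega⟩
  refine ⟨k, by omega, by rw [hn, hk]; simp, ?_⟩
  rw [← he, hn, hk]
  push_cast
  module

lemma path_hgt {pi : D.V} (hpi : D.IsDominant pi) {u : D.W} (m : List D.V) : ∀ w : D.W,
    D.ArrowPathFromTo (D.stab pi) u w m →
    (m.length : ℚ) ≤ D.hgt (D.act u pi - D.act w pi) ∧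
    (D.hgt (D.act u pi - D.act w pi) ≤ m.length →
      ∃ l : List D.I, l.map D.simple = m ∧ w = D.wordProd l * u) := by
  induction m with
  | nil =>
    intro w h
    have h : u = w := h
    subst h
    refine ⟨by simp, fun _ => ⟨[], rfl, by simp [wordProd]⟩⟩
  | cons β m ih =>
    rintro w ⟨x, ha, hp⟩
    obtain ⟨ih1, ih2⟩ := ih x hp
    obtain ⟨k, hk, hco, hxw⟩ := arrow_weight hpi ha
    obtain ⟨n, hn, hh, hsimp⟩ := pos_hgt ha.1
    have he : D.hgt (D.act u pi - D.act w pi)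
        = D.hgt (D.act u pi - D.act x pi) + ((k * n : ℕ) : ℚ) := by
      rw [hxw, map_sub, map_sub, map_add, map_smul, hh]
      push_cast
      simp only [smul_eq_mul]; ring
    have hkn : 1 ≤ k * n := Nat.mul_pos hk hn
    have hkn' : (1 : ℚ) ≤ ((k * n : ℕ) : ℚ) := by exact_mod_cast hkn
    rw [he]
    simp only [List.length_cons]
    push_cast at hkn' ⊢
    refine ⟨by linarith, fun hle => ?_⟩
    obtain ⟨l, hl, hx⟩ := ih2 (by linarith)
    have h1 : (k * n : ℚ) ≤ 1 := by linarith
    have h2 : k * n ≤ 1 := by exact_mod_cast h1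
    have h3 : k * n = 1 := le_antisymm h2 hkn
    obtain ⟨i, rfl⟩ := hsimp (Nat.eq_one_of_mul_eq_one_left h3)
    have hk1 : k = 1 := Nat.eq_one_of_mul_eq_one_right h3
    refine ⟨i :: l, by simp [hl], ?_⟩
    have hlt : D.length (D.s i * w) < D.length w := by
      apply descent hpi (simple_pos i)
      rw [hco, hk1]; norm_num
    have hge := length_le_s_mul i w
    have hmin : D.IsMinRep (D.stab pi) (D.s i * w) := by
      apply minRep_step (i := i)
      · rw [s_s]; exact ha.2.2.1
      · rw [s_s]; omega
    have hxs : D.s i * w = x := minRep_unique hpi _ _ _ rfl hmin ha.2.1 (by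
      rw [act_mul, act_s, hxw, hco]; simp)
    rw [wordProd_cons, mul_assoc, ← hx, ← hxs, s_s]

end WeylSetting

/-- For `π`-minuscule `u < w` in `W^P` with `d = ℓ(w) - ℓ(u)`, the map sending a
reduced word `w u⁻¹ = s_{β₁} ⋯ s_{β_d}` to the path
`u = x_d →β_d ⋯ → x_1 →β₁ x_0 = w` is a bijection from the reduced words of
`w u⁻¹` onto the maximal-length directed paths from `u` to `w` in `W^P`. -/
theorem reduced_words_bij_maximal_paths
    (D : WeylSetting) (pi : D.V) (hpi : D.IsDominant pi)
    (u w : D.W) (hu : D.IsMinuscule pi u) (hw : D.IsMinuscule pi w)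
    (hur : D.IsMinRep (D.stab pi) u) (hwr : D.IsMinRep (D.stab pi) w)
    (huw : D.bruhatLT u w) :
    Set.BijOn (fun l : List D.I => l.map D.simple)
      {l : List D.I | D.IsReduced l (w * u⁻¹)}
      {m : List D.V | D.ArrowPathFromTo (D.stab pi) u w m ∧
        m.length = D.length w - D.length u} := by
  have hMu := WeylSetting.Mn_of_minuscule hur hu
  have hMw := WeylSetting.Mn_of_minuscule hwr hw
  have hweak := WeylSetting.weak_of_bruhat hpi _ u w rfl hMu hMw huw.1
  refine ⟨?_, ?_, ?_⟩
  · rintro l ⟨hl1, hl2⟩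
    have he : D.wordProd l * u = w := by rw [hl1]; group
    have hlen : D.length (D.wordProd l * u) = l.length + D.length u := by rw [he]; omega
    have := WeylSetting.path_of_word hpi l (by rw [he]; exact hMw) hlen
    rw [he] at this
    refine ⟨this, ?_⟩
    simp only [List.length_map]
    omega
  · exact (List.map_injective_iff.mpr WeylSetting.simple_injective).injOn
  · rintro m ⟨hm, hlen⟩
    obtain ⟨l, hl, hwl⟩ := (WeylSetting.path_hgt hpi m w hm).2 (by
      have h1 := hMu.2
      have h2 := hMw.2
      have h3 : m.length + D.length u = D.length w := by omega
      have h4 : (m.length : ℚ) + D.length u = D.length w := by exact_mod_cast h3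
      rw [map_sub] at h1 h2 ⊢
      linarith)
    refine ⟨l, ⟨?_, ?_⟩, hl⟩
    · rw [hwl]; group
    · have : l.length = m.length := by rw [← hl]; simp
      omega
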